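/- arXiv:1308.5272 — 4 statements merged into one kernel-verified Lean document; each statement's English description precedes it below -/
import Mathlib

section
/- Let G be a finite set and T a finite set of production segments, where each t ∈ T has an input good j_t ∈ G, an output good j'_t ∈ G with j'_t ≠ j_t, and a weight α_t > 0. Assume that for every cyclic sequence t_1, …, t_m ∈ T with j'_{t_s} = j_{t_{s+1}} (indices mod m), the product ∏_{s=1}^m α_{t_s} is strictly less than 1. Then the polyhedron C = {c ∈ ℝ^G : c_j ≥ 1 for all j ∈ G, and α_t · c_{j'_t} ≤ c_{j_t} for all t ∈ T} is non-empty, and moreover it has non-empty interior: there exists c with c_j > 1 for all j ∈ G and α_t · c_{j'_t} < c_{j_t} for all t ∈ T. -/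
/-- `WeightedWalk E j k w` says that some non-empty walk from `j` to `k` along edges
`(source, target, weight)` in `E` has weights multiplying to `w`. -/
inductive WeightedWalk {G : Type} (E : Set (G × G × ℝ)) : G → G → ℝ → Prop
  | edge {j k : G} {w : ℝ} (h : (j, k, w) ∈ E) : WeightedWalk E j k w
  | cons {i j k : G} {v w : ℝ} (h : (i, j, v) ∈ E) (p : WeightedWalk E j k w) :
      WeightedWalk E i k (v * w)

namespace WeightedWalk

variable {G : Type} {E F : Set (G × G × ℝ)}

theorem append {i j k : G} {v w : ℝ} (p : WeightedWalk E i j v) (q : WeightedWalk E j k w) :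
    WeightedWalk E i k (v * w) := by
  induction p with
  | edge h => exact .cons h q
  | cons h _ ih => rw [mul_assoc]; exact .cons h (ih q)

/-- If every edge of `F` is realised by a walk in `E`, so is every walk in `F`. -/
theorem of_edges (hF : ∀ j k w, (j, k, w) ∈ F → WeightedWalk E j k w) {j k : G} {w : ℝ}
    (p : WeightedWalk F j k w) : WeightedWalk E j k w := by
  induction p with
  | edge h => exact hF _ _ _ h
  | cons h _ ih => exact (hF _ _ _ h).append ih

theorem exists_segments {T : Type} {jin jout : T → G} {α : T → ℝ} {j k : G} {w : ℝ}
    (p : WeightedWalk (Set.range fun t => (jin t, jout t, α t)) j k w) :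
    ∃ (n : ℕ) (ts : Fin (n + 1) → T), jin (ts 0) = j ∧ jout (ts (Fin.last n)) = k ∧
      (∀ i : Fin n, jout (ts i.castSucc) = jin (ts i.succ)) ∧ ∏ i, α (ts i) = w := by
  induction p with
  | edge h =>
    obtain ⟨t, ht⟩ := h
    simp only [Prod.mk.injEq] at ht
    exact ⟨0, fun _ => t, ht.1, ht.2.1, fun i => i.elim0, by simpa using ht.2.2⟩
  | cons h _ ih =>
    obtain ⟨t, ht⟩ := h
    simp only [Prod.mk.injEq] at ht
    obtain ⟨n, ts, h0, hlast, hstep, hprod⟩ := ih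
    refine ⟨n + 1, Fin.cons t ts, ht.1, ?_, fun i => ?_, ?_⟩
    · rwa [← Fin.succ_last, Fin.cons_succ]
    · refine Fin.cases ?_ (fun i => ?_) i
      · rw [Fin.castSucc_zero, Fin.cons_zero, Fin.cons_succ, h0, ht.2.1]
      · rw [Fin.castSucc_succ, Fin.cons_succ, Fin.cons_succ]
        exact hstep i
    · rw [Fin.prod_univ_succ]
      simp only [Fin.cons_zero, Fin.cons_succ]
      rw [hprod, ht.2.2]

end WeightedWalk

/-- Eliminating the vertices of `S` one at a time, as in Fourier-Motzkin elimination. -/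
theorem exists_pos_potential {G : Type} (S : Finset G) :
    ∀ E : Set (G × G × ℝ), E.Finite → (∀ j k w, (j, k, w) ∈ E → 0 < w) →
      (∀ j w, WeightedWalk E j j w → w < 1) →
      ∃ c : G → ℝ, (∀ j, 0 < c j) ∧ ∀ j k w, (j, k, w) ∈ E → j ∈ S → k ∈ S → w * c k < c j := by
  classical
  induction S using Finset.induction_on with
  | empty => exact fun E _ _ _ => ⟨fun _ => 1, fun _ => one_pos, by simp⟩
  | insert v S hv ih =>
    intro E hfin hpos hcyc
    let F : Set (G × G × ℝ) := {e | ∃ w₁ w₂, (e.1, v, w₁) ∈ E ∧ (v, e.2.1, w₂) ∈ E ∧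
      e.2.2 = w₁ * w₂}
    have hF : F.Finite := by
      refine (Set.Finite.image2 (fun a b : G × G × ℝ => (a.1, b.2.1, a.2.2 * b.2.2))
        hfin hfin).subset ?_
      rintro ⟨j, k, w⟩ ⟨w₁, w₂, h₁, h₂, rfl⟩
      exact ⟨_, h₁, _, h₂, rfl⟩
    obtain ⟨c, hc, hcE⟩ := ih (E ∪ F) (hfin.union hF)
      (by
        rintro j k w (h | ⟨w₁, w₂, h₁, h₂, rfl⟩)
        · exact hpos _ _ _ h
        · exact mul_pos (hpos _ _ _ h₁) (hpos _ _ _ h₂))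
      (by
        refine fun j w p => hcyc j w (p.of_edges ?_)
        rintro j k w (h | ⟨w₁, w₂, h₁, h₂, rfl⟩)
        · exact .edge h
        · exact .cons h₁ (.edge h₂))
    obtain ⟨x, hlo, hup⟩ := Set.Finite.exists_between'
      (s := insert 0 ((fun e => e.2.2 * c e.2.1) '' {e ∈ E | e.1 = v ∧ e.2.1 ∈ S}))
      (t := (fun e => c e.1 / e.2.2) '' {e ∈ E | e.2.1 = v ∧ e.1 ∈ S})
      (((hfin.sep _).image _).insert _) ((hfin.sep _).image _)
      (by
        rintro a ha _ ⟨⟨j, k, w⟩, ⟨h, rfl, hj⟩, rfl⟩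
        have hw := hpos _ _ _ h
        obtain rfl | ⟨⟨i, l, u⟩, ⟨h', rfl, hl⟩, rfl⟩ := ha
        · exact div_pos (hc _) hw
        · have := hcE j l (w * u) (Or.inr ⟨w, u, h, h', rfl⟩) hj hl
          rw [lt_div_iff₀ hw]
          dsimp only
          linarith)
    have hx : 0 < x := hlo 0 (Set.mem_insert _ _)
    refine ⟨Function.update c v x, fun j => ?_, fun j k w h hj hk => ?_⟩
    · obtain rfl | hj := eq_or_ne j v
      · simpa using hx
      · simpa [hj] using hc j
    have hw := hpos _ _ _ h
    obtain rfl | hjS := Finset.mem_insert.1 hj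
    · obtain rfl | hkS := Finset.mem_insert.1 hk
      · simpa using mul_lt_of_lt_one_left hx (hcyc _ _ (.edge h))
      · rw [Function.update_self, Function.update_of_ne (ne_of_mem_of_not_mem hkS hv)]
        exact hlo _ (Or.inr ⟨_, ⟨h, rfl, hkS⟩, rfl⟩)
    · rw [Function.update_of_ne (ne_of_mem_of_not_mem hjS hv)]
      obtain rfl | hkS := Finset.mem_insert.1 hk
      · rw [Function.update_self, mul_comm]
        exact (lt_div_iff₀ hw).1 (hup _ ⟨_, ⟨h, rfl, hjS⟩, rfl⟩)
      · rw [Function.update_of_ne (ne_of_mem_of_not_mem hkS hv)]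
        exact hcE _ _ _ (Or.inl h) hjS hkS


/-- Let `G` be a finite set of goods and `T` a finite set of production segments, where
segment `t` converts good `jin t` into good `jout t ≠ jin t` at rate `α t > 0`. If along
every cyclic sequence of segments the rates multiply to strictly less than `1` (no
production out of nothing), then the polyhedron
`C = {c : c j ≥ 1 for all j, and α t · c (jout t) ≤ c (jin t) for all t}` is non-empty,
and moreover it has non-empty interior. -/
theorem stmt1 {G T : Type} [Fintype G] [Fintype T]
    (jin jout : T → G) (hne : ∀ t, jout t ≠ jin t)
    (α : T → ℝ) (hα : ∀ t, 0 < α t)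
    (hcycle : ∀ (m : ℕ) (ts : Fin (m + 1) → T),
      (∀ s, jout (ts s) = jin (ts (s + 1))) → ∏ s, α (ts s) < 1) :
    (∃ c : G → ℝ, (∀ j, 1 ≤ c j) ∧ ∀ t, α t * c (jout t) ≤ c (jin t)) ∧
    (∃ c : G → ℝ, (∀ j, 1 < c j) ∧ ∀ t, α t * c (jout t) < c (jin t)) := by
  suffices h : ∃ c : G → ℝ, (∀ j, 1 < c j) ∧ ∀ t, α t * c (jout t) < c (jin t) by
    obtain ⟨c, h₁, h₂⟩ := h
    exact ⟨⟨c, fun j => (h₁ j).le, fun t => (h₂ t).le⟩, c, h₁, h₂⟩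
  obtain ⟨c, hc, hcE⟩ := exists_pos_potential Finset.univ
    (Set.range fun t => (jin t, jout t, α t)) (Set.finite_range _)
    (by
      rintro j k w ⟨t, ht⟩
      simp only [Prod.mk.injEq] at ht
      exact ht.2.2 ▸ hα t)
    (by
      intro j w p
      obtain ⟨n, ts, h0, hlast, hstep, rfl⟩ := p.exists_segments
      refine hcycle n ts fun s => ?_
      refine Fin.lastCases ?_ (fun i => ?_) s
      · rw [Fin.last_add_one, hlast, h0]
      · rw [Fin.coeSucc_eq_succ, hstep])
  have hM : 0 < 1 + ∑ i, (c i)⁻¹ :=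
    add_pos_of_pos_of_nonneg one_pos (Finset.sum_nonneg fun i _ => (inv_pos.2 (hc i)).le)
  refine ⟨fun j => (1 + ∑ i, (c i)⁻¹) * c j, fun j => ?_, fun t => ?_⟩
  · rw [← div_lt_iff₀ (hc j), one_div]
    have := Finset.single_le_sum (f := fun i => (c i)⁻¹)
      (fun i _ => (inv_pos.2 (hc i)).le) (Finset.mem_univ j)
    linarith
  · rw [mul_left_comm]
    exact mul_lt_mul_of_pos_left
      (hcE _ _ _ ⟨t, rfl⟩ (Finset.mem_univ _) (Finset.mem_univ _)) hM
end

section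
/- Let M be an SPLC market satisfying no production out of nothing. If desire(j) > 1 for every good j, then at every market equilibrium of M all prices are strictly positive. -/
open scoped Classical

noncomputable section

/-- An SPLC market: finitely many goods `G`, agents `A`, and firms `F`;
endowments `w`, firm ownership shares `θ`, firm `f` produces good `jf f`;
agent `i`'s utility for good `j` is SPLC with `numU i j` segments of slopes `u i j k`
and lengths `l i j k` (`k < numU i j`); firm `f`'s production of good `jf f` from
raw good `j` is SPLC with `numP f j` segments of slopes `α f j k` and lengths `o f j k`. -/
structure SPLCMarket where
  (G A F : Type)
  [instG : Fintype G]
  [instA : Fintype A]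
  [instF : Fintype F]
  (w : A → G → ℝ)
  (w_nonneg : ∀ i j, 0 ≤ w i j)
  (w_sum : ∀ j, ∑ i, w i j = 1)
  (jf : F → G)
  (θ : A → F → ℝ)
  (θ_nonneg : ∀ i f, 0 ≤ θ i f)
  (θ_sum : ∀ f, ∑ i, θ i f = 1)
  (numU : A → G → ℕ)
  (numU_pos : ∀ i j, 0 < numU i j)
  (u : A → G → ℕ → ℝ)
  (l : A → G → ℕ → ℝ)
  (u_nonneg : ∀ i j k, k < numU i j → 0 ≤ u i j k)
  (l_pos : ∀ i j k, k < numU i j → 0 < l i j k)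
  (u_anti : ∀ i j k, k + 1 < numU i j → u i j (k + 1) < u i j k)
  (numP : F → G → ℕ)
  (numP_pos : ∀ f j, 0 < numP f j)
  (α : F → G → ℕ → ℝ)
  (o : F → G → ℕ → ℝ)
  (α_nonneg : ∀ f j k, k < numP f j → 0 ≤ α f j k)
  (o_pos : ∀ f j k, k < numP f j → 0 < o f j k)
  (α_anti : ∀ f j k, k + 1 < numP f j → α f j (k + 1) < α f j k)

attribute [instance] SPLCMarket.instG SPLCMarket.instA SPLCMarket.instF

namespace SPLCMarket

variable (M : SPLCMarket)

/-- A segment-indexed allocation: nonnegative, within segment lengths, zero beyond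
the actual segments. -/
def IsSegAlloc (num : M.G → ℕ) (len : M.G → ℕ → ℝ) (x : M.G → ℕ → ℝ) : Prop :=
  ∀ j k, 0 ≤ x j k ∧ (k < num j → x j k ≤ len j k) ∧ (num j ≤ k → x j k = 0)

/-- A production plan of firm `f`: amounts of raw goods used on each segment. -/
def IsPlan (f : M.F) (x : M.G → ℕ → ℝ) : Prop :=
  M.IsSegAlloc (M.numP f) (M.o f) x

/-- Profit of plan `x` of firm `f` at prices `p`. -/
def planProfit (f : M.F) (p : M.G → ℝ) (x : M.G → ℕ → ℝ) : ℝ :=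
  ∑ j, ∑ k ∈ Finset.range (M.numP f j), x j k * (M.α f j k * p (M.jf f) - p j)

/-- Amount of good `jf f` produced by plan `x` of firm `f`. -/
def planOutput (f : M.F) (x : M.G → ℕ → ℝ) : ℝ :=
  ∑ j, ∑ k ∈ Finset.range (M.numP f j), M.α f j k * x j k

/-- A profit-maximizing production plan. -/
def OptimalPlan (f : M.F) (p : M.G → ℝ) (x : M.G → ℕ → ℝ) : Prop :=
  M.IsPlan f x ∧ ∀ x', M.IsPlan f x' → M.planProfit f p x' ≤ M.planProfit f p x

/-- Amount allocated to segment `k` when an amount `t` is filled greedily along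
segments of lengths `len 0, len 1, …`. -/
def segAmt (len : ℕ → ℝ) (k : ℕ) (t : ℝ) : ℝ :=
  max 0 (min (len k) (t - ∑ k' ∈ Finset.range k, len k'))

/-- The (separable piecewise-linear concave) utility of agent `i` for bundle `x`. -/
def utilFn (i : M.A) (x : M.G → ℝ) : ℝ :=
  ∑ j, ∑ k ∈ Finset.range (M.numU i j), M.u i j k * segAmt (M.l i j) k (x j)

/-- Utility of a segment-indexed allocation of agent `i`. -/
def segUtility (i : M.A) (x : M.G → ℕ → ℝ) : ℝ :=
  ∑ j, ∑ k ∈ Finset.range (M.numU i j), M.u i j k * x j k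

/-- Cost of bundle `x` at prices `p`. -/
def bundleCost (p : M.G → ℝ) (x : M.G → ℝ) : ℝ := ∑ j, p j * x j

/-- `x` is an optimal (budget-constrained utility-maximizing) bundle for agent `i`. -/
def OptimalBundleAmt (i : M.A) (p : M.G → ℝ) (B : ℝ) (x : M.G → ℝ) : Prop :=
  (∀ j, 0 ≤ x j) ∧ M.bundleCost p x ≤ B ∧
    ∀ y : M.G → ℝ, (∀ j, 0 ≤ y j) → M.bundleCost p y ≤ B → M.utilFn i y ≤ M.utilFn i x

/-- A segment-indexed optimal bundle for agent `i`: affordable, and its utility is at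
least that of any affordable bundle. -/
def OptimalBundle (i : M.A) (p : M.G → ℝ) (B : ℝ) (x : M.G → ℕ → ℝ) : Prop :=
  M.IsSegAlloc (M.numU i) (M.l i) x ∧
  M.bundleCost p (fun j => ∑ k ∈ Finset.range (M.numU i j), x j k) ≤ B ∧
  ∀ y : M.G → ℝ, (∀ j, 0 ≤ y j) → M.bundleCost p y ≤ B → M.utilFn i y ≤ M.segUtility i x

/-- Budget of agent `i` at prices `p` when firms' (maximum) profits are `E`. -/
def budget (i : M.A) (p : M.G → ℝ) (E : M.F → ℝ) : ℝ :=
  ∑ j, M.w i j * p j + ∑ f, M.θ i f * E f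

/-- Market equilibrium: nonnegative prices, profit-maximizing plans (with `E f` the
maximum profit of firm `f`), optimal bundles, and market clearing for every good. -/
def IsEquilibrium (p : M.G → ℝ) (xF : M.F → M.G → ℕ → ℝ) (xA : M.A → M.G → ℕ → ℝ)
    (E : M.F → ℝ) : Prop :=
  (∀ j, 0 ≤ p j) ∧
  (∀ f, M.OptimalPlan f p (xF f) ∧ E f = M.planProfit f p (xF f)) ∧
  (∀ i, M.OptimalBundle i p (M.budget i p E) (xA i)) ∧
  (∀ j, (∑ i, ∑ k ∈ Finset.range (M.numU i j), xA i j k)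
      + (∑ f, ∑ k ∈ Finset.range (M.numP f j), xF f j k)
      = 1 + ∑ f, if M.jf f = j then M.planOutput f (xF f) else 0)

/-- No production out of nothing: along every cyclic sequence of (first segments of)
productions, the rates multiply to strictly less than `1`. -/
def NoProductionOutOfNothing : Prop :=
  ∀ (m : ℕ) (fs : Fin (m + 1) → M.F) (gs : Fin (m + 1) → M.G),
    (∀ t, 0 < M.α (fs t) (gs t) 0) → (∀ t, M.jf (fs t) = gs (t + 1)) →
    ∏ t, M.α (fs t) (gs t) 0 < 1

/-- Total amount of good `j` represented by agents' segments with positive slope. -/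
def desire (j : M.G) : ℝ :=
  ∑ i, ∑ k ∈ (Finset.range (M.numU i j)).filter (fun k => 0 < M.u i j k), M.l i j k

def EnoughDemand : Prop := ∀ j, 1 < M.desire j

/-- A node (agent or firm) possesses/produces good `j`. -/
def owns : M.A ⊕ M.F → M.G → Prop
  | Sum.inl i, j => 0 < M.w i j
  | Sum.inr f, j => M.jf f = j

/-- A node (agent or firm) is non-satiated by good `j`: its last segment for `j`
has positive slope. -/
def nonsat : M.A ⊕ M.F → M.G → Prop
  | Sum.inl i, j => 0 < M.u i j (M.numU i j - 1)
  | Sum.inr f, j => 0 < M.α f j (M.numP f j - 1)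

/-- Edge of the graph `G(M)`. -/
def edge (a b : M.A ⊕ M.F) : Prop := ∃ j, M.owns a j ∧ M.nonsat b j

/-- Strong connectivity: all agent nodes lie in one strongly connected component of `G(M)`. -/
def StrongConnectivity : Prop :=
  ∀ i i' : M.A, Relation.ReflTransGen M.edge (Sum.inl i) (Sum.inl i')

/-- The largest production slope (or `0`). -/
def αmax : ℝ := sSup (insert 0 {x | ∃ f j k, k < M.numP f j ∧ M.α f j k = x})

/-- The smallest positive production slope. -/
def αminpos : ℝ := sInf {x | 0 < x ∧ ∃ f j k, k < M.numP f j ∧ M.α f j k = x}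

/-- The safe bound `L = n^n (α_max + 1)^n`. -/
def Lbig : ℝ :=
  (Fintype.card M.G : ℝ) ^ (Fintype.card M.G) * (M.αmax + 1) ^ (Fintype.card M.G)

/-- Lengths of last segments are fixed to the safe values. -/
def SafeLengths : Prop :=
  (∀ f j, M.o f j (M.numP f j - 1) = M.Lbig / max 1 M.αminpos) ∧
  (∀ i j, M.l i j (M.numU i j - 1) = M.Lbig + 1)

/-- Revenue from production of good `j`: `∑_{f : jf f = j} ∑_{j',k} s^f_{j'k}`,
where `s^f_{jk} = r^f_{jk} + o^f_{jk} β^f_{jk}`. -/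
def prodRevenue (r β : M.F → M.G → ℕ → ℝ) (j : M.G) : ℝ :=
  ∑ f, if M.jf f = j then
      ∑ j', ∑ k ∈ Finset.range (M.numP f j'), (r f j' k + M.o f j' k * β f j' k)
    else 0

/-- The profit `E^f = ∑_{j,k} o^f_{jk} β^f_{jk}` of firm `f` in the LCP. -/
def lcpProfit (β : M.F → M.G → ℕ → ℝ) (f : M.F) : ℝ :=
  ∑ j, ∑ k ∈ Finset.range (M.numP f j), M.o f j k * β f j k

/-- The common core of AD-LCP, NHAD-LCP and NHAD-LCP': all constraints and
complementarity conditions, with prices `p`, good-clearing complementarity multiplier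
`pc`, and `zsub` subtracted in the agents' constraints. -/
def LCPCore (lam : M.A → ℝ) (p pc : M.G → ℝ) (q γ : M.A → M.G → ℕ → ℝ)
    (r β : M.F → M.G → ℕ → ℝ) (zsub : ℝ) : Prop :=
  (∀ i, 0 ≤ lam i) ∧
  (∀ i j k, 0 ≤ q i j k ∧ 0 ≤ γ i j k ∧ (M.numU i j ≤ k → q i j k = 0 ∧ γ i j k = 0)) ∧
  (∀ f j k, 0 ≤ r f j k ∧ 0 ≤ β f j k ∧ (M.numP f j ≤ k → r f j k = 0 ∧ β f j k = 0)) ∧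
  (∀ f j k, k < M.numP f j →
    M.α f j k * p (M.jf f) - p j ≤ β f j k ∧
    r f j k * (M.α f j k * p (M.jf f) - p j - β f j k) = 0) ∧
  (∀ f j k, k < M.numP f j →
    r f j k ≤ M.o f j k * p j ∧ β f j k * (r f j k - M.o f j k * p j) = 0) ∧
  (∀ j, (∑ i, ∑ k ∈ Finset.range (M.numU i j), q i j k)
      + (∑ f, ∑ k ∈ Finset.range (M.numP f j), r f j k)
      ≤ p j + M.prodRevenue r β j ∧
    pc j * ((∑ i, ∑ k ∈ Finset.range (M.numU i j), q i j k)
      + (∑ f, ∑ k ∈ Finset.range (M.numP f j), r f j k)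
      - p j - M.prodRevenue r β j) = 0) ∧
  (∀ i, (∑ j, M.w i j * p j) + (∑ f, M.θ i f * M.lcpProfit β f)
      - (∑ j, ∑ k ∈ Finset.range (M.numU i j), q i j k) - zsub ≤ 0 ∧
    lam i * ((∑ j, M.w i j * p j) + (∑ f, M.θ i f * M.lcpProfit β f)
      - (∑ j, ∑ k ∈ Finset.range (M.numU i j), q i j k) - zsub) = 0) ∧
  (∀ i j k, k < M.numU i j →
    M.u i j k * lam i ≤ p j + γ i j k ∧
    q i j k * (M.u i j k * lam i - p j - γ i j k) = 0) ∧
  (∀ i j k, k < M.numU i j →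
    q i j k ≤ M.l i j k * p j ∧ γ i j k * (q i j k - M.l i j k * p j) = 0)

/-- AD-LCP. -/
def ADLCP (lam : M.A → ℝ) (p : M.G → ℝ) (q γ : M.A → M.G → ℕ → ℝ)
    (r β : M.F → M.G → ℕ → ℝ) : Prop :=
  (∀ j, 0 ≤ p j) ∧ M.LCPCore lam p p q γ r β 0

/-- The vector `c` of price lower bounds: `c j > 1` and no segment has positive
profit at prices `c`. -/
def GoodPriceLB (c : M.G → ℝ) : Prop :=
  (∀ j, 1 < c j) ∧ ∀ f j k, k < M.numP f j → M.α f j k * c (M.jf f) < c j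

/-- NHAD-LCP: AD-LCP with `p j = p' j + c j`, the good-clearing complementarity
multiplier being `p'`. -/
def NHADLCP (c : M.G → ℝ) (lam : M.A → ℝ) (p' : M.G → ℝ) (q γ : M.A → M.G → ℕ → ℝ)
    (r β : M.F → M.G → ℕ → ℝ) : Prop :=
  (∀ j, 0 ≤ p' j) ∧ M.LCPCore lam (fun j => p' j + c j) p' q γ r β 0

/-- NHAD-LCP': NHAD-LCP augmented with the variable `z` in the agents' constraints. -/
def NHADLCP' (c : M.G → ℝ) (lam : M.A → ℝ) (p' : M.G → ℝ) (q γ : M.A → M.G → ℕ → ℝ)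
    (r β : M.F → M.G → ℕ → ℝ) (z : ℝ) : Prop :=
  (∀ j, 0 ≤ p' j) ∧ 0 ≤ z ∧ M.LCPCore lam (fun j => p' j + c j) p' q γ r β z

end SPLCMarket

namespace SPLCMarket

/-- Abel summation: nonnegative partial sums paired with nonnegative decreasing weights. -/
theorem sum_mul_nonneg_of_antitone (n : ℕ) (u d : ℕ → ℝ) (hu : ∀ k < n, 0 ≤ u k)
    (hanti : ∀ k, k + 1 < n → u (k + 1) ≤ u k)
    (hd : ∀ m ≤ n, 0 ≤ ∑ k ∈ Finset.range m, d k) :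
    0 ≤ ∑ k ∈ Finset.range n, u k * d k := by
  have key : ∀ m, m < n →
      u m * ∑ k ∈ Finset.range (m + 1), d k ≤ ∑ k ∈ Finset.range (m + 1), u k * d k := by
    intro m
    induction m with
    | zero => intro _; simp
    | succ m ih =>
      intro hm
      rw [Finset.sum_range_succ _ (m + 1), Finset.sum_range_succ _ (m + 1), mul_add]
      have h1 := ih (by omega)
      have h2 := mul_le_mul_of_nonneg_right (hanti m hm) (hd (m + 1) (by omega))
      linarith
  rcases n with _ | n
  · simp
  · exact (mul_nonneg (hu n (by omega)) (hd _ le_rfl)).trans (key n (by omega))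

theorem sum_segAmt (len : ℕ → ℝ) (t : ℝ) (ht : 0 ≤ t) (m : ℕ) (hlen : ∀ k < m, 0 ≤ len k) :
    ∑ k ∈ Finset.range m, segAmt len k t = min t (∑ k ∈ Finset.range m, len k) := by
  induction m with
  | zero => simp [ht]
  | succ m ih =>
    rw [Finset.sum_range_succ, Finset.sum_range_succ, ih fun k hk => hlen k (by omega), segAmt]
    have := hlen m (by omega)
    grind

/-- Filling segments greedily is at least as good as any other filling with the same total. -/
theorem sum_mul_le_sum_mul_segAmt (n : ℕ) (u len x : ℕ → ℝ) (hu : ∀ k < n, 0 ≤ u k)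
    (hanti : ∀ k, k + 1 < n → u (k + 1) ≤ u k)
    (hx : ∀ k < n, 0 ≤ x k) (hxl : ∀ k < n, x k ≤ len k) :
    ∑ k ∈ Finset.range n, u k * x k ≤
      ∑ k ∈ Finset.range n, u k * segAmt len k (∑ k ∈ Finset.range n, x k) := by
  have h := sum_mul_nonneg_of_antitone n u
    (fun k => segAmt len k (∑ k ∈ Finset.range n, x k) - x k) hu hanti ?_
  · simp only [mul_sub, Finset.sum_sub_distrib] at h
    linarith
  · intro m hm
    rw [Finset.sum_sub_distrib, sub_nonneg, sum_segAmt, le_min_iff]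
    · refine ⟨Finset.sum_le_sum_of_subset_of_nonneg (by simpa using hm) ?_,
        Finset.sum_le_sum fun k hk => hxl k ?_⟩
      · intro k hk _
        exact hx k (by simpa using hk)
      · have := Finset.mem_range.1 hk
        omega
    · exact Finset.sum_nonneg fun k hk => hx k (by simpa using hk)
    · intro k hk
      exact (hx k (by omega)).trans (hxl k (by omega))

theorem segAmt_sum (n : ℕ) (len : ℕ → ℝ) (hlen : ∀ k < n, 0 ≤ len k) {k : ℕ} (hk : k < n) :
    segAmt len k (∑ k ∈ Finset.range n, len k) = len k := by
  have h : ∑ k' ∈ Finset.range (k + 1), len k' ≤ ∑ k' ∈ Finset.range n, len k' :=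
    Finset.sum_le_sum_of_subset_of_nonneg (by simpa using hk)
      fun i hi _ => hlen i (by simpa using hi)
  rw [Finset.sum_range_succ] at h
  rw [segAmt, min_eq_left (by linarith), max_eq_right (hlen k hk)]

variable (M : SPLCMarket)

/-- A free good is consumed by every agent up to satiation. -/
theorem OptimalBundle.eq_length_of_price_eq_zero {M : SPLCMarket} {i : M.A} {p : M.G → ℝ}
    {B : ℝ} {x : M.G → ℕ → ℝ} (h : M.OptimalBundle i p B x) {j : M.G} (hj : p j = 0)
    {k : ℕ} (hk : k < M.numU i j) (hu : 0 < M.u i j k) : x j k = M.l i j k := by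
  obtain ⟨hseg, hcost, hopt⟩ := h
  have hl : ∀ j, ∀ k < M.numU i j, 0 ≤ M.l i j k := fun j k hk => (M.l_pos i j k hk).le
  have hle := hopt (fun j' => if j' = j then ∑ k ∈ Finset.range (M.numU i j), M.l i j k
    else ∑ k ∈ Finset.range (M.numU i j'), x j' k) ?_ ?_
  · have hother : ∀ j' ∈ Finset.univ.erase j,
        ∑ k ∈ Finset.range (M.numU i j'), M.u i j' k * x j' k ≤
        ∑ k ∈ Finset.range (M.numU i j'), M.u i j' k * segAmt (M.l i j') k
          (if j' = j then ∑ k ∈ Finset.range (M.numU i j), M.l i j k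
            else ∑ k ∈ Finset.range (M.numU i j'), x j' k) := by
      intro j' hj'
      rw [if_neg (Finset.ne_of_mem_erase hj')]
      exact sum_mul_le_sum_mul_segAmt _ _ _ _ (M.u_nonneg i j')
        (fun k hk => (M.u_anti i j' k hk).le) (fun k _ => (hseg j' k).1)
        (fun k hk => (hseg j' k).2.1 hk)
    have hsum := Finset.sum_le_sum hother
    simp only [utilFn, segUtility] at hle
    rw [← Finset.add_sum_erase _ _ (Finset.mem_univ j),
      ← Finset.add_sum_erase _ _ (Finset.mem_univ j), if_pos rfl] at hle
    have hfull : ∑ k ∈ Finset.range (M.numU i j), M.u i j k *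
          segAmt (M.l i j) k (∑ k ∈ Finset.range (M.numU i j), M.l i j k) =
        ∑ k ∈ Finset.range (M.numU i j), M.u i j k * M.l i j k :=
      Finset.sum_congr rfl fun k hk => by
        rw [segAmt_sum _ _ (hl j) (Finset.mem_range.1 hk)]
    rw [hfull] at hle
    have hterm : ∀ k ∈ Finset.range (M.numU i j),
        M.u i j k * x j k ≤ M.u i j k * M.l i j k := fun k hk =>
      mul_le_mul_of_nonneg_left ((hseg j k).2.1 (Finset.mem_range.1 hk))
        (M.u_nonneg i j k (Finset.mem_range.1 hk))
    have heq := (Finset.sum_eq_sum_iff_of_le hterm).1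
      (le_antisymm (Finset.sum_le_sum hterm) (by linarith)) k (Finset.mem_range.2 hk)
    exact mul_left_cancel₀ hu.ne' heq
  · intro j'
    split_ifs with hjj
    · exact Finset.sum_nonneg fun k hk => hl j k (Finset.mem_range.1 hk)
    · exact Finset.sum_nonneg fun k _ => (hseg j' k).1
  · refine le_trans (Finset.sum_le_sum fun j' _ => ?_) hcost
    dsimp only
    split_ifs with hjj
    · simp [hjj, hj]
    · exact le_rfl

/-- A firm whose product is free buys no good of positive price. -/
theorem OptimalPlan.eq_zero_of_price_eq_zero {M : SPLCMarket} {f : M.F} {p : M.G → ℝ}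
    {x : M.G → ℕ → ℝ} (h : M.OptimalPlan f p x) (hp : ∀ j, 0 ≤ p j) (hf : p (M.jf f) = 0)
    {j : M.G} (hj : p j ≠ 0) (k : ℕ) (hk : k < M.numP f j) : x j k = 0 := by
  obtain ⟨hplan, hopt⟩ := h
  have h0 := hopt (fun _ _ => 0) fun j k =>
    ⟨le_rfl, fun hk => (M.o_pos f j k hk).le, fun _ => rfl⟩
  simp only [planProfit, hf, mul_zero, zero_sub, zero_mul, Finset.sum_const_zero, mul_neg,
    Finset.sum_neg_distrib, neg_zero, Left.nonneg_neg_iff] at h0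
  have hnn : ∀ j k, 0 ≤ x j k * p j := fun j k => mul_nonneg (hplan j k).1 (hp j)
  have h1 := (Finset.sum_eq_zero_iff_of_nonneg
    fun j _ => Finset.sum_nonneg fun k _ => hnn j k).1
    (le_antisymm h0 (Finset.sum_nonneg fun j _ => Finset.sum_nonneg fun k _ => hnn j k))
    j (Finset.mem_univ j)
  have h2 := (Finset.sum_eq_zero_iff_of_nonneg fun k _ => hnn j k).1 h1 k (Finset.mem_range.2 hk)
  exact (mul_eq_zero.1 h2).resolve_right hj

/-- The product of the first-segment rates along a chain of firms, starting from good `j`. -/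
def chainRate : M.G → List M.F → ℝ
  | _, [] => 1
  | j, f :: l => M.α f j 0 * chainRate (M.jf f) l

theorem α_zero_nonneg (f : M.F) (j : M.G) : 0 ≤ M.α f j 0 :=
  M.α_nonneg f j 0 (M.numP_pos f j)

theorem chainRate_nonneg (j : M.G) (l : List M.F) : 0 ≤ M.chainRate j l := by
  induction l generalizing j with
  | nil => simp [chainRate]
  | cons f l ih => exact mul_nonneg (M.α_zero_nonneg f j) (ih _)

theorem chainRate_append_cons (j : M.G) (l₁ : List M.F) (f : M.F) (l₂ : List M.F) :
    M.chainRate j (l₁ ++ f :: l₂) =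
      M.chainRate j (l₁ ++ [f]) * M.chainRate (M.jf f) l₂ := by
  induction l₁ generalizing j with
  | nil => simp [chainRate]
  | cons g l ih => simp [chainRate, ih, mul_assoc]

theorem chainRate_ofFn (m : ℕ) (fs : Fin (m + 1) → M.F) (j : M.G) :
    M.chainRate j (List.ofFn fs) =
      M.α (fs 0) j 0 * ∏ t : Fin m, M.α (fs t.succ) (M.jf (fs t.castSucc)) 0 := by
  induction m generalizing j with
  | zero => simp [chainRate]
  | succ m ih =>
    rw [List.ofFn_succ, chainRate, ih, Fin.prod_univ_succ]
    simp

variable {M}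

theorem NoProductionOutOfNothing.chainRate_lt_one (hnp : M.NoProductionOutOfNothing)
    (l : List M.F) (f : M.F) : M.chainRate (M.jf f) (l ++ [f]) < 1 := by
  have hfun : ∀ (m : ℕ) (fs : Fin (m + 1) → M.F),
      M.chainRate (M.jf (fs (Fin.last m))) (List.ofFn fs) < 1 := by
    intro m fs
    have hprod : M.chainRate (M.jf (fs (Fin.last m))) (List.ofFn fs) =
        ∏ t, M.α (fs t) (M.jf (fs (t - 1))) 0 := by
      rw [chainRate_ofFn, Fin.prod_univ_succ]
      congr 2
      · rw [show (0 : Fin (m + 1)) - 1 = Fin.last m by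
          rw [sub_eq_iff_eq_add]; simp]
      · funext t
        rw [show t.succ - 1 = t.castSucc by rw [sub_eq_iff_eq_add]; simp]
    rw [hprod]
    by_cases hpos : ∀ t, 0 < M.α (fs t) (M.jf (fs (t - 1))) 0
    · exact hnp m fs (fun t => M.jf (fs (t - 1))) hpos (by simp)
    · push Not at hpos
      obtain ⟨t, ht⟩ := hpos
      rw [Finset.prod_eq_zero (Finset.mem_univ t) (le_antisymm ht (M.α_zero_nonneg _ _))]
      exact one_pos
  have h := hfun l.length (Fin.snoc (α := fun _ => M.F) l.get f)
  rw [List.ofFn_succ'] at h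
  simpa only [Fin.snoc_last, Fin.snoc_castSucc, List.ofFn_get, List.concat_eq_append] using h

/-- No production out of nothing yields strictly positive prices at which no firm makes a
positive profit. -/
theorem NoProductionOutOfNothing.exists_price (hnp : M.NoProductionOutOfNothing) :
    ∃ c : M.G → ℝ, (∀ j, 0 < c j) ∧ ∀ f j, M.α f j 0 * c (M.jf f) ≤ c j := by
  have hmax : ∀ j : M.G, ∃ l : List M.F, (j :: l.map M.jf).Nodup ∧
      ∀ l' : List M.F, (j :: l'.map M.jf).Nodup → M.chainRate j l' ≤ M.chainRate j l := by
    intro j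
    have hfin : {l : List M.F | (j :: l.map M.jf).Nodup}.Finite :=
      (Set.finite_coe_iff.1 (Fintype.finite fintypeNodupList)).subset
        fun l hl => List.Nodup.of_map _ (List.nodup_cons.1 hl).2
    exact Set.exists_max_image _ (M.chainRate j) hfin
      ⟨[], show (j :: [].map M.jf).Nodup by simp⟩
  choose L hL hLmax using hmax
  refine ⟨fun j => M.chainRate j (L j), fun j => ?_, fun f j => ?_⟩
  · exact one_pos.trans_le (hLmax j [] (by simp))
  · change M.chainRate j (f :: L (M.jf f)) ≤ _
    have hnd : ((f :: L (M.jf f)).map M.jf).Nodup := hL (M.jf f)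
    by_cases hj : j ∈ (f :: L (M.jf f)).map M.jf
    · obtain ⟨g, hg, rfl⟩ := List.mem_map.1 hj
      obtain ⟨l₁, l₂, hl⟩ := List.append_of_mem hg
      rw [hl] at hnd ⊢
      rw [chainRate_append_cons]
      rw [List.map_append, List.map_cons] at hnd
      exact (mul_le_of_le_one_left (M.chainRate_nonneg _ _)
        (hnp.chainRate_lt_one l₁ g).le).trans (hLmax _ l₂ hnd.of_append_right)
    · exact hLmax j _ (List.nodup_cons.2 ⟨hj, hnd⟩)

theorem α_le_α_zero (f : M.F) (j : M.G) (k : ℕ) (hk : k < M.numP f j) :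
    M.α f j k ≤ M.α f j 0 := by
  induction k with
  | zero => rfl
  | succ k ih => exact (M.α_anti f j k hk).le.trans (ih (by omega))

/-- At prices where no firm profits, the value of a plan's output is at most that of its
input. -/
theorem mul_planOutput_le {c : M.G → ℝ} (hc : ∀ j, 0 < c j)
    (hα : ∀ f j, M.α f j 0 * c (M.jf f) ≤ c j) {f : M.F} {x : M.G → ℕ → ℝ}
    (hx : M.IsPlan f x) :
    c (M.jf f) * M.planOutput f x ≤
      ∑ j, c j * ∑ k ∈ Finset.range (M.numP f j), x j k := by
  simp only [planOutput, Finset.mul_sum]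
  refine Finset.sum_le_sum fun j _ => Finset.sum_le_sum fun k hk => ?_
  rw [← mul_assoc]
  refine mul_le_mul_of_nonneg_right ?_ (hx j k).1
  have := mul_le_mul_of_nonneg_left (α_le_α_zero f j k (Finset.mem_range.1 hk)) (hc (M.jf f)).le
  linarith [hα f j]

/-- Agents consume at least the desired amount of a free good. -/
theorem desire_le_of_price_eq_zero {p : M.G → ℝ} {B : M.A → ℝ} {x : M.A → M.G → ℕ → ℝ}
    (h : ∀ i, M.OptimalBundle i p (B i) (x i)) {j : M.G} (hj : p j = 0) :
    M.desire j ≤ ∑ i, ∑ k ∈ Finset.range (M.numU i j), x i j k := by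
  refine Finset.sum_le_sum fun i _ => ?_
  rw [Finset.sum_congr rfl fun k hk => ((h i).eq_length_of_price_eq_zero hj
    (Finset.mem_range.1 (Finset.mem_filter.1 hk).1) (Finset.mem_filter.1 hk).2).symm]
  exact Finset.sum_le_sum_of_subset_of_nonneg (Finset.filter_subset _ _)
    fun k _ _ => ((h i).1 j k).1

end SPLCMarket

/-- If the SPLC market `M` satisfies no production out of nothing and `desire j > 1`
for every good `j`, then all prices are strictly positive at every market equilibrium. -/
theorem stmt3 (M : SPLCMarket) (hsafe : M.SafeLengths)
    (hnp : M.NoProductionOutOfNothing) (hdem : M.EnoughDemand)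
    (p : M.G → ℝ) (xF : M.F → M.G → ℕ → ℝ) (xA : M.A → M.G → ℕ → ℝ) (E : M.F → ℝ)
    (heq : M.IsEquilibrium p xF xA E) :
    ∀ j, 0 < p j := by
  obtain ⟨hp, hfirm, hagent, hclear⟩ := heq
  obtain ⟨c, hc, hα⟩ := hnp.exists_price
  by_contra! hneg
  obtain ⟨j₀, hj₀⟩ := hneg
  set Z : Finset M.G := Finset.univ.filter fun j => p j = 0 with hZ
  have hmem : ∀ j, j ∈ Z ↔ p j = 0 := by simp [hZ]
  have hnn : ∀ f j, 0 ≤ ∑ k ∈ Finset.range (M.numP f j), xF f j k := fun f j =>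
    Finset.sum_nonneg fun k _ => ((hfirm f).1.1 j k).1
  have hlt : ∀ j ∈ Z, c j * ∑ f, ∑ k ∈ Finset.range (M.numP f j), xF f j k <
      c j * ∑ f, if M.jf f = j then M.planOutput f (xF f) else 0 := by
    intro j hj
    have h1 := SPLCMarket.desire_le_of_price_eq_zero hagent ((hmem j).1 hj)
    have h2 := hdem j
    have h3 := hclear j
    exact mul_lt_mul_of_pos_left (by linarith) (hc j)
  have hsum := Finset.sum_lt_sum_of_nonempty
    ⟨j₀, (hmem j₀).2 (le_antisymm hj₀ (hp j₀))⟩ hlt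
  refine hsum.not_ge ?_
  simp only [Finset.mul_sum (s := (Finset.univ : Finset M.F))]
  rw [Finset.sum_comm, Finset.sum_comm (s := Z)]
  refine Finset.sum_le_sum fun f _ => ?_
  simp only [mul_ite, mul_zero, Finset.sum_ite_eq]
  split_ifs with hf
  · refine (SPLCMarket.mul_planOutput_le hc hα (hfirm f).1.1).trans_eq
      (Finset.sum_subset (Finset.subset_univ Z) fun j _ hj => ?_).symm
    rw [Finset.sum_eq_zero fun k hk => (hfirm f).1.eq_zero_of_price_eq_zero hp
      ((hmem _).1 hf) (fun h => hj ((hmem j).2 h)) k (Finset.mem_range.1 hk), mul_zero]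
  · exact Finset.sum_nonneg fun j _ => mul_nonneg (hc j).le (hnn f j)
end
end

section
/- At any solution of NHAD-LCP, each firm produces as per a profit-maximizing production plan with respect to the prices p = p' + c: for every firm f, the amounts x^f_{jk} := r^f_{jk}/(p'_j + c_j) form an optimal production plan for f at prices p, the produced revenue satisfies s^f_{jk}/(p'_{j_f} + c_{j_f}) = α^f_{jk} · x^f_{jk} for every segment (f,j,k), and E^f equals the maximum profit of firm f at prices p. -/
open scoped Classical

noncomputable section

namespace SPLCMarket

variable {M : SPLCMarket}

theorem GoodPriceLB.price_pos {c p' : M.G → ℝ} (hc : M.GoodPriceLB c) (hp' : ∀ j, 0 ≤ p' j)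
    (j : M.G) : 0 < p' j + c j := by
  linarith [hp' j, hc.1 j]

/-- On each segment, the complementarity conditions make the value `o β` of the dual variable
equal to the profit earned on that segment. -/
theorem LCPCore.o_mul_β_eq_profit {lam : M.A → ℝ} {p pc : M.G → ℝ} {q γ : M.A → M.G → ℕ → ℝ}
    {r β : M.F → M.G → ℕ → ℝ} {zsub : ℝ} (h : M.LCPCore lam p pc q γ r β zsub)
    {f : M.F} {j : M.G} {k : ℕ} (hk : k < M.numP f j) (hp : p j ≠ 0) :
    M.o f j k * β f j k = r f j k / p j * (M.α f j k * p (M.jf f) - p j) := by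
  obtain ⟨-, -, -, hβ, hr, -⟩ := h
  rw [div_mul_eq_mul_div, eq_div_iff hp]
  linear_combination -(hβ f j k hk).2 - (hr f j k hk).2

theorem LCPCore.lcpProfit_eq_planProfit {lam : M.A → ℝ} {p pc : M.G → ℝ}
    {q γ : M.A → M.G → ℕ → ℝ} {r β : M.F → M.G → ℕ → ℝ} {zsub : ℝ}
    (h : M.LCPCore lam p pc q γ r β zsub) (hp : ∀ j, p j ≠ 0) (f : M.F) :
    M.lcpProfit β f = M.planProfit f p (fun j k => r f j k / p j) :=
  Finset.sum_congr rfl fun j _ => Finset.sum_congr rfl fun _ hk =>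
    h.o_mul_β_eq_profit (Finset.mem_range.1 hk) (hp j)

theorem LCPCore.isPlan {lam : M.A → ℝ} {p pc : M.G → ℝ} {q γ : M.A → M.G → ℕ → ℝ}
    {r β : M.F → M.G → ℕ → ℝ} {zsub : ℝ} (h : M.LCPCore lam p pc q γ r β zsub)
    (hp : ∀ j, 0 < p j) (f : M.F) : M.IsPlan f (fun j k => r f j k / p j) := by
  obtain ⟨-, -, hsign, -, hr, -⟩ := h
  refine fun j k => ⟨div_nonneg (hsign f j k).1 (hp j).le,
    fun hk => (div_le_iff₀ (hp j)).2 (hr f j k hk).1, fun hk => ?_⟩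
  simp [((hsign f j k).2.2 hk).1]

/-- Weak duality: no plan earns more than `E^f`. -/
theorem LCPCore.planProfit_le_lcpProfit {lam : M.A → ℝ} {p pc : M.G → ℝ}
    {q γ : M.A → M.G → ℕ → ℝ} {r β : M.F → M.G → ℕ → ℝ} {zsub : ℝ}
    (h : M.LCPCore lam p pc q γ r β zsub) {f : M.F} {x : M.G → ℕ → ℝ} (hx : M.IsPlan f x) :
    M.planProfit f p x ≤ M.lcpProfit β f := by
  obtain ⟨-, -, hsign, hβ, -⟩ := h
  refine Finset.sum_le_sum fun j _ => Finset.sum_le_sum fun k hk => ?_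
  have hk := Finset.mem_range.1 hk
  calc x j k * (M.α f j k * p (M.jf f) - p j)
      ≤ x j k * β f j k := mul_le_mul_of_nonneg_left (hβ f j k hk).1 (hx j k).1
    _ ≤ M.o f j k * β f j k :=
      mul_le_mul_of_nonneg_right ((hx j k).2.1 hk) (hsign f j k).2.1

end SPLCMarket

/-- At any solution of NHAD-LCP, each firm produces as per a profit-maximizing plan at
prices `p = p' + c`: the amounts `x^f_{jk} = r^f_{jk}/(p'_j + c_j)` form an optimal plan,
`s^f_{jk}/(p'_{j_f} + c_{j_f}) = α^f_{jk} x^f_{jk}` for each segment, and `E^f` equals the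
maximum profit of firm `f` at prices `p`. -/
theorem stmt6 (M : SPLCMarket) (hsafe : M.SafeLengths) (c : M.G → ℝ) (hc : M.GoodPriceLB c)
    (lam : M.A → ℝ) (p' : M.G → ℝ) (q γ : M.A → M.G → ℕ → ℝ) (r β : M.F → M.G → ℕ → ℝ)
    (hsol : M.NHADLCP c lam p' q γ r β) (f : M.F) :
    M.OptimalPlan f (fun j => p' j + c j) (fun j k => r f j k / (p' j + c j)) ∧
    (∀ j k, k < M.numP f j →
      (r f j k + M.o f j k * β f j k) / (p' (M.jf f) + c (M.jf f))
        = M.α f j k * (r f j k / (p' j + c j))) ∧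
    M.lcpProfit β f
      = M.planProfit f (fun j => p' j + c j) (fun j k => r f j k / (p' j + c j)) := by
  obtain ⟨hp', hcore⟩ := hsol
  have hp := hc.price_pos hp'
  have hE := hcore.lcpProfit_eq_planProfit (fun j => (hp j).ne') f
  refine ⟨⟨hcore.isPlan hp f, fun x hx => ?_⟩, fun j k hk => ?_, hE⟩
  · exact hE ▸ hcore.planProfit_le_lcpProfit hx
  · rw [hcore.o_mul_β_eq_profit hk (hp j).ne', div_eq_iff (hp (M.jf f)).ne']
    field_simp [(hp j).ne']
    ring
end
end

section
/- At any solution of NHAD-LCP, the market clears with respect to the prices p = p' + c: for every good j the constraint ∑_{i,k} q^i_{jk} + ∑_{f,k} r^f_{jk} ≤ (p'_j + c_j) + ∑_{f: j_f=j} ∑_{j',k} s^f_{j'k} holds with equality, and for every agent i the constraint ∑_j w^i_j (p'_j + c_j) + ∑_f θ^i_f E^f ≤ ∑_{j,k} q^i_{jk} holds with equality. -/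
open scoped Classical

noncomputable section

namespace SPLCMarket

/-- Total production revenue is the total cost of raw goods plus the total profit of firms. -/
theorem sum_prodRevenue (M : SPLCMarket) (r β : M.F → M.G → ℕ → ℝ) :
    ∑ j, M.prodRevenue r β j
      = (∑ j, ∑ f, ∑ k ∈ Finset.range (M.numP f j), r f j k) + ∑ f, M.lcpProfit β f := by
  unfold prodRevenue lcpProfit
  rw [Finset.sum_comm, Finset.sum_comm (f := fun j f => ∑ k ∈ Finset.range (M.numP f j), r f j k)]
  simp [Finset.sum_add_distrib]

/-- Agents' total income is the total value of all goods plus the total profit of firms. -/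
theorem sum_income (M : SPLCMarket) (p : M.G → ℝ) (E : M.F → ℝ) :
    ∑ i, ((∑ j, M.w i j * p j) + ∑ f, M.θ i f * E f) = ∑ j, p j + ∑ f, E f := by
  rw [Finset.sum_add_distrib, Finset.sum_comm, Finset.sum_comm (f := fun i f => M.θ i f * E f)]
  simp [← Finset.sum_mul, M.w_sum, M.θ_sum]

end SPLCMarket

/-- At any solution of NHAD-LCP, the market clears at prices `p = p' + c`: the
good-clearing constraint holds with equality for every good and the budget constraint
holds with equality for every agent. -/
theorem stmt8 (M : SPLCMarket) (hsafe : M.SafeLengths) (c : M.G → ℝ) (hc : M.GoodPriceLB c)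
    (lam : M.A → ℝ) (p' : M.G → ℝ) (q γ : M.A → M.G → ℕ → ℝ) (r β : M.F → M.G → ℕ → ℝ)
    (hsol : M.NHADLCP c lam p' q γ r β) :
    (∀ j, (∑ i, ∑ k ∈ Finset.range (M.numU i j), q i j k)
        + (∑ f, ∑ k ∈ Finset.range (M.numP f j), r f j k)
        = (p' j + c j) + M.prodRevenue r β j) ∧
    (∀ i, (∑ j, M.w i j * (p' j + c j)) + (∑ f, M.θ i f * M.lcpProfit β f)
        = ∑ j, ∑ k ∈ Finset.range (M.numU i j), q i j k) := by
  obtain ⟨-, -, -, -, -, -, hgood, hagent, -⟩ := hsol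
  have hG : ∀ j ∈ Finset.univ, (∑ i, ∑ k ∈ Finset.range (M.numU i j), q i j k)
      + (∑ f, ∑ k ∈ Finset.range (M.numP f j), r f j k)
      ≤ (p' j + c j) + M.prodRevenue r β j := fun j _ => (hgood j).1
  have hA : ∀ i ∈ Finset.univ,
      (∑ j, M.w i j * (p' j + c j)) + (∑ f, M.θ i f * M.lcpProfit β f)
      ≤ ∑ j, ∑ k ∈ Finset.range (M.numU i j), q i j k := fun i _ => by
    linarith [(hagent i).1]
  have hGsum := Finset.sum_le_sum hG
  have hAsum := Finset.sum_le_sum hA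
  have hincome := M.sum_income (fun j => p' j + c j) (M.lcpProfit β)
  have hrevenue := M.sum_prodRevenue r β
  have hswap : ∑ j, ∑ i, ∑ k ∈ Finset.range (M.numU i j), q i j k
      = ∑ i, ∑ j, ∑ k ∈ Finset.range (M.numU i j), q i j k := Finset.sum_comm
  have hGeq := (Finset.sum_eq_sum_iff_of_le hG).1 (by
    refine le_antisymm hGsum ?_
    rw [Finset.sum_add_distrib (f := fun j => p' j + c j),
      Finset.sum_add_distrib (f := fun j => ∑ i, ∑ k ∈ Finset.range (M.numU i j), q i j k)]
    linarith)
  have hAeq := (Finset.sum_eq_sum_iff_of_le hA).1 (by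
    refine le_antisymm hAsum ?_
    rw [Finset.sum_add_distrib (f := fun j => p' j + c j),
      Finset.sum_add_distrib (f := fun j => ∑ i, ∑ k ∈ Finset.range (M.numU i j), q i j k)] at hGsum
    linarith)
  exact ⟨fun j => hGeq j (Finset.mem_univ j), fun i => hAeq i (Finset.mem_univ i)⟩
end
end
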